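/- Let d ≥ 1, let t₁, …, t_d ∈ ℝ^d be Euclidean unit vectors, let α₁, …, α_d ∈ ℝ, and set β := Σ_{i=1}^d αᵢ tᵢ. Let C > 0 and suppose that for each index j there is a vector n_j ∈ ℝ^d such that ⟨n_j, tᵢ⟩ = 0 for every i ≠ j and |⟨n_j, t_j⟩| ≥ C. Then there exists an index j with |⟨β, n_j⟩| ≥ C · (max_{1 ≤ k ≤ d} |β_k|) / d, where β_k denotes the k-th component of β and ⟨·,·⟩ is the Euclidean inner product. -/

import Mathlib

open RealInnerProductSpace

/-- Normal-domination bound of Appendix A (constant velocity case): if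
`β = Σᵢ αᵢ tᵢ` with unit edge directions `tᵢ`, and each facet normal `n_j` is
orthogonal to all `tᵢ`, `i ≠ j`, with `|⟨n_j, t_j⟩| ≥ C`, then on some facet
`|⟨β, n_j⟩| ≥ C (max_k |β_k|)/d`. -/
theorem normal_domination (d : ℕ) (hd : 1 ≤ d)
    (t : Fin d → EuclideanSpace ℝ (Fin d)) (ht : ∀ i, ‖t i‖ = 1)
    (α : Fin d → ℝ) (C : ℝ) (hC : 0 < C)
    (n : Fin d → EuclideanSpace ℝ (Fin d))
    (hortho : ∀ j i, i ≠ j → ⟪n j, t i⟫ = 0)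
    (hangle : ∀ j, C ≤ |⟪n j, t j⟫|) :
    ∃ j : Fin d,
      C * (⨆ k : Fin d, |(∑ i : Fin d, α i • t i) k|) / d ≤
        |⟪(∑ i : Fin d, α i • t i), n j⟫| := by
  haveI : Nonempty (Fin d) := ⟨⟨0, hd⟩⟩
  obtain ⟨j, hj⟩ := Finite.exists_max (fun i => |α i|)
  refine ⟨j, ?_⟩
  have hd' : (0 : ℝ) < d := by exact_mod_cast hd
  have hsup : (⨆ k : Fin d, |(∑ i : Fin d, α i • t i) k|) ≤ d * |α j| := by
    apply ciSup_le
    intro k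
    calc |(∑ i : Fin d, α i • t i) k| ≤ ‖∑ i : Fin d, α i • t i‖ := by
          simpa only [Real.norm_eq_abs] using PiLp.norm_apply_le (∑ i : Fin d, α i • t i) k
      _ ≤ ∑ i : Fin d, ‖α i • t i‖ := norm_sum_le _ _
      _ ≤ ∑ _i : Fin d, |α j| := by
          apply Finset.sum_le_sum
          intro i _
          rw [norm_smul, ht, mul_one, Real.norm_eq_abs]
          exact hj i
      _ = d * |α j| := by simp
  have hin : ⟪(∑ i : Fin d, α i • t i), n j⟫ = α j * ⟪n j, t j⟫ := by
    rw [real_inner_comm, inner_sum, Finset.sum_eq_single j]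
    · rw [inner_smul_right]
    · intro i _ hi
      rw [inner_smul_right, hortho j i hi, mul_zero]
    · simp
  rw [hin, abs_mul, div_le_iff₀ hd']
  have h1 := mul_le_mul_of_nonneg_left hsup hC.le
  have h2 := mul_le_mul_of_nonneg_left (hangle j) (mul_nonneg hd'.le (abs_nonneg (α j)))
  linarith
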